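/- arXiv:1405.7546 — 2 statements merged into one kernel-verified Lean document; each statement's English description precedes it below -/
import Mathlib

section
/- The T-ideal of polynomial identities of the infinite-dimensional Grassmann algebra E is generated as a T-ideal by the triple commutator [x₁,x₂,x₃]; that is, T(E) = ⟨[x₁,x₂,x₃]⟩^T. -/
noncomputable section

/-- `f ∈ K⟨X⟩` (with set of variables `X`) is a polynomial identity of the `K`-algebra `R`:
every substitution of elements of `R` for the variables (i.e. every `K`-algebra homomorphism
from the free algebra to `R`) kills `f`. -/
def IsPI (K : Type) [Field K] {X : Type} (R : Type) [Ring R] [Algebra K R]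
    (f : FreeAlgebra K X) : Prop :=
  ∀ φ : FreeAlgebra K X →ₐ[K] R, φ f = 0

/-- `T(R)`: the set of polynomial identities of `R` inside `K⟨x₁, x₂, …⟩`
(the free unital associative algebra on countably many variables, indexed by `ℕ`). -/
def TId (K : Type) [Field K] (R : Type) [Ring R] [Algebra K R] : Set (FreeAlgebra K ℕ) :=
  {f | IsPI K R f}

/-- A two-sided ideal of `K⟨X⟩` is a T-ideal when it is invariant under all algebra
endomorphisms of `K⟨X⟩`. -/
def IsTIdeal (K : Type) [Field K] (I : TwoSidedIdeal (FreeAlgebra K ℕ)) : Prop :=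
  ∀ φ : FreeAlgebra K ℕ →ₐ[K] FreeAlgebra K ℕ, ∀ f ∈ I, φ f ∈ I

/-- `⟨F⟩^T`: the smallest T-ideal of `K⟨X⟩` containing the set `F`. -/
def TIdealGen (K : Type) [Field K] (F : Set (FreeAlgebra K ℕ)) : Set (FreeAlgebra K ℕ) :=
  {g | ∀ I : TwoSidedIdeal (FreeAlgebra K ℕ), IsTIdeal K I → F ⊆ (I : Set (FreeAlgebra K ℕ)) → g ∈ I}

/-- The commutator `[a, b] = a * b - b * a`. -/
def br {R : Type} [Ring R] (a b : R) : R := a * b - b * a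

/-- The left-normed commutator `[a, b, b, …, b]` with `k` occurrences of `b`. -/
def commPow {R : Type} [Ring R] (a b : R) (k : ℕ) : R := (fun y => br y b)^[k] a

/-- The variable `xᵢ` of `K⟨x₁, x₂, …⟩` (1-based indexing). -/
def xv (K : Type) [Field K] (i : ℕ) : FreeAlgebra K ℕ := FreeAlgebra.ι K i

/-- The product of commutators `[x₁,x₂][x₃,x₄]⋯[x_{2k-1},x_{2k}]`. -/
def chainProd (K : Type) [Field K] (k : ℕ) : FreeAlgebra K ℕ :=
  ((List.range k).map fun i => br (xv K (2 * i + 1)) (xv K (2 * i + 2))).prod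

/-- The Grassmann (exterior) algebra of an infinite dimensional `K`-vector space
with basis `e₁, e₂, …`. -/
abbrev Einf (K : Type) [Field K] : Type := ExteriorAlgebra K (ℕ →₀ K)

/-- The Grassmann (exterior) algebra `E⁽ⁿ⁾` of an `n`-dimensional `K`-vector space. -/
abbrev Efin (K : Type) [Field K] (n : ℕ) : Type := ExteriorAlgebra K (Fin n → K)

/-- The even part `E₀` of the Grassmann algebra of `V`. -/
def evenPart (K V : Type) [Field K] [AddCommGroup V] [Module K V] :
    Submodule K (ExteriorAlgebra K V) :=
  CliffordAlgebra.evenOdd (0 : QuadraticForm K V) 0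

/-- The odd part `E₁` of the Grassmann algebra of `V`. -/
def oddPart (K V : Type) [Field K] [AddCommGroup V] [Module K V] :
    Submodule K (ExteriorAlgebra K V) :=
  CliffordAlgebra.evenOdd (0 : QuadraticForm K V) 1

section matrixAlgebras

variable (K V : Type) [Field K] [AddCommGroup V] [Module K V]

private theorem evenPart_mul_mem {a b : ExteriorAlgebra K V}
    (ha : a ∈ evenPart K V) (hb : b ∈ evenPart K V) : a * b ∈ evenPart K V := by
  have := CliffordAlgebra.evenOdd_mul_le (Q := (0 : QuadraticForm K V)) 0 0
    (Submodule.mul_mem_mul ha hb)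
  simpa [evenPart] using this

private theorem evenPart_one_mem : (1 : ExteriorAlgebra K V) ∈ evenPart K V :=
  SetLike.one_mem_graded _

private theorem evenPart_algebraMap_mem (c : K) :
    algebraMap K (ExteriorAlgebra K V) c ∈ evenPart K V :=
  SetLike.algebraMap_mem_graded _ c

/-- The algebra `A` (over the Grassmann algebra of `V`): the subalgebra of `2 × 2`
matrices over `E = Λ(V)` whose `(1,1)` entry lies in `E₀`, whose `(2,1)` entry is `0`,
and whose `(1,2)` and `(2,2)` entries are arbitrary. -/
def algA : Subalgebra K (Matrix (Fin 2) (Fin 2) (ExteriorAlgebra K V)) where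
  carrier := {M | M 0 0 ∈ evenPart K V ∧ M 1 0 = 0}
  mul_mem' := by
    rintro a b ⟨ha0, ha1⟩ ⟨hb0, hb1⟩
    refine ⟨?_, ?_⟩
    · have h : (a * b) 0 0 = a 0 0 * b 0 0 + a 0 1 * b 1 0 := by
        simp [Matrix.mul_apply, Fin.sum_univ_two]
      rw [h, hb1, mul_zero, add_zero]
      exact evenPart_mul_mem K V ha0 hb0
    · have h : (a * b) 1 0 = a 1 0 * b 0 0 + a 1 1 * b 1 0 := by
        simp [Matrix.mul_apply, Fin.sum_univ_two]
      rw [h, ha1, hb1, zero_mul, mul_zero, add_zero]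
  one_mem' := by
    refine ⟨?_, ?_⟩
    · rw [Matrix.one_apply_eq]; exact evenPart_one_mem K V
    · exact Matrix.one_apply_ne (by decide)
  add_mem' := by
    rintro a b ⟨ha0, ha1⟩ ⟨hb0, hb1⟩
    exact ⟨Submodule.add_mem _ ha0 hb0, by simp [ha1, hb1]⟩
  zero_mem' := ⟨Submodule.zero_mem _, rfl⟩
  algebraMap_mem' := fun c => by
    refine ⟨?_, ?_⟩
    · rw [Matrix.algebraMap_matrix_apply, if_pos rfl]
      exact evenPart_algebraMap_mem K V c
    · rw [Matrix.algebraMap_matrix_apply, if_neg (by decide)]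

end matrixAlgebras

section matrixAlgebras2

variable (K V : Type) [Field K] [AddCommGroup V] [Module K V]

private theorem oddPart_mul_mem_even {a b : ExteriorAlgebra K V}
    (ha : a ∈ oddPart K V) (hb : b ∈ oddPart K V) : a * b ∈ evenPart K V := by
  have := CliffordAlgebra.evenOdd_mul_le (Q := (0 : QuadraticForm K V)) 1 1
    (Submodule.mul_mem_mul ha hb)
  have h2 : ((1 : ZMod 2) + 1) = 0 := by decide
  rw [h2] at this
  exact this

private theorem even_mul_odd_mem {a b : ExteriorAlgebra K V}
    (ha : a ∈ evenPart K V) (hb : b ∈ oddPart K V) : a * b ∈ oddPart K V := by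
  have := CliffordAlgebra.evenOdd_mul_le (Q := (0 : QuadraticForm K V)) 0 1
    (Submodule.mul_mem_mul ha hb)
  rw [zero_add] at this
  exact this

private theorem odd_mul_even_mem {a b : ExteriorAlgebra K V}
    (ha : a ∈ oddPart K V) (hb : b ∈ evenPart K V) : a * b ∈ oddPart K V := by
  have := CliffordAlgebra.evenOdd_mul_le (Q := (0 : QuadraticForm K V)) 1 0
    (Submodule.mul_mem_mul ha hb)
  rw [add_zero] at this
  exact this

/-- The algebra `A′` (over the Grassmann algebra of `V`): the subalgebra of `2 × 2`
matrices over `E = Λ(V)` whose `(2,2)` entry lies in `E₀`, whose `(2,1)` entry is `0`,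
and whose `(1,1)` and `(1,2)` entries are arbitrary. -/
def algA' : Subalgebra K (Matrix (Fin 2) (Fin 2) (ExteriorAlgebra K V)) where
  carrier := {M | M 1 1 ∈ evenPart K V ∧ M 1 0 = 0}
  mul_mem' := by
    rintro a b ⟨ha0, ha1⟩ ⟨hb0, hb1⟩
    refine ⟨?_, ?_⟩
    · have h : (a * b) 1 1 = a 1 0 * b 0 1 + a 1 1 * b 1 1 := by
        simp [Matrix.mul_apply, Fin.sum_univ_two]
      rw [h, ha1, zero_mul, zero_add]
      exact evenPart_mul_mem K V ha0 hb0
    · have h : (a * b) 1 0 = a 1 0 * b 0 0 + a 1 1 * b 1 0 := by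
        simp [Matrix.mul_apply, Fin.sum_univ_two]
      rw [h, ha1, hb1, zero_mul, mul_zero, add_zero]
  one_mem' := by
    refine ⟨?_, ?_⟩
    · rw [Matrix.one_apply_eq]; exact evenPart_one_mem K V
    · exact Matrix.one_apply_ne (by decide)
  add_mem' := by
    rintro a b ⟨ha0, ha1⟩ ⟨hb0, hb1⟩
    exact ⟨Submodule.add_mem _ ha0 hb0, by simp [ha1, hb1]⟩
  zero_mem' := ⟨Submodule.zero_mem _, rfl⟩
  algebraMap_mem' := fun c => by
    refine ⟨?_, ?_⟩
    · rw [Matrix.algebraMap_matrix_apply, if_pos rfl]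
      exact evenPart_algebraMap_mem K V c
    · rw [Matrix.algebraMap_matrix_apply, if_neg (by decide)]

/-- The algebra `M_{1,1}` (over the Grassmann algebra of `V`): the subalgebra of `2 × 2`
matrices over `E = Λ(V)` whose diagonal entries lie in `E₀` and whose off-diagonal entries
lie in `E₁`. -/
def m11 : Subalgebra K (Matrix (Fin 2) (Fin 2) (ExteriorAlgebra K V)) where
  carrier := {M | M 0 0 ∈ evenPart K V ∧ M 1 1 ∈ evenPart K V ∧
    M 0 1 ∈ oddPart K V ∧ M 1 0 ∈ oddPart K V}
  mul_mem' := by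
    rintro a b ⟨ha00, ha11, ha01, ha10⟩ ⟨hb00, hb11, hb01, hb10⟩
    have h00 : (a * b) 0 0 = a 0 0 * b 0 0 + a 0 1 * b 1 0 := by
      simp [Matrix.mul_apply, Fin.sum_univ_two]
    have h11 : (a * b) 1 1 = a 1 0 * b 0 1 + a 1 1 * b 1 1 := by
      simp [Matrix.mul_apply, Fin.sum_univ_two]
    have h01 : (a * b) 0 1 = a 0 0 * b 0 1 + a 0 1 * b 1 1 := by
      simp [Matrix.mul_apply, Fin.sum_univ_two]
    have h10 : (a * b) 1 0 = a 1 0 * b 0 0 + a 1 1 * b 1 0 := by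
      simp [Matrix.mul_apply, Fin.sum_univ_two]
    refine ⟨?_, ?_, ?_, ?_⟩
    · rw [h00]
      exact Submodule.add_mem _ (evenPart_mul_mem K V ha00 hb00)
        (oddPart_mul_mem_even K V ha01 hb10)
    · rw [h11]
      exact Submodule.add_mem _ (oddPart_mul_mem_even K V ha10 hb01)
        (evenPart_mul_mem K V ha11 hb11)
    · rw [h01]
      exact Submodule.add_mem _ (even_mul_odd_mem K V ha00 hb01)
        (odd_mul_even_mem K V ha01 hb11)
    · rw [h10]
      exact Submodule.add_mem _ (odd_mul_even_mem K V ha10 hb00)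
        (even_mul_odd_mem K V ha11 hb10)
  one_mem' := by
    refine ⟨?_, ?_, ?_, ?_⟩
    · rw [Matrix.one_apply_eq]; exact evenPart_one_mem K V
    · rw [Matrix.one_apply_eq]; exact evenPart_one_mem K V
    · rw [Matrix.one_apply_ne (by decide)]; exact Submodule.zero_mem _
    · rw [Matrix.one_apply_ne (by decide)]; exact Submodule.zero_mem _
  add_mem' := by
    rintro a b ⟨ha00, ha11, ha01, ha10⟩ ⟨hb00, hb11, hb01, hb10⟩
    exact ⟨Submodule.add_mem _ ha00 hb00, Submodule.add_mem _ ha11 hb11,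
      Submodule.add_mem _ ha01 hb01, Submodule.add_mem _ ha10 hb10⟩
  zero_mem' := ⟨Submodule.zero_mem _, Submodule.zero_mem _,
    Submodule.zero_mem _, Submodule.zero_mem _⟩
  algebraMap_mem' := fun c => by
    refine ⟨?_, ?_, ?_, ?_⟩
    · rw [Matrix.algebraMap_matrix_apply, if_pos rfl]
      exact evenPart_algebraMap_mem K V c
    · rw [Matrix.algebraMap_matrix_apply, if_pos rfl]
      exact evenPart_algebraMap_mem K V c
    · rw [Matrix.algebraMap_matrix_apply, if_neg (by decide)]
      exact Submodule.zero_mem _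
    · rw [Matrix.algebraMap_matrix_apply, if_neg (by decide)]
      exact Submodule.zero_mem _

end matrixAlgebras2

/-- The relatively free algebra `F_n(R) = K⟨x₁, …, xₙ⟩ / (K⟨x₁, …, xₙ⟩ ∩ T(R))` of rank `n`
of the variety generated by `R`: the quotient of the free algebra on `n` variables by the
ideal of polynomial identities of `R` in those variables. -/
abbrev RelFree (K : Type) [Field K] (R : Type) [Ring R] [Algebra K R] (n : ℕ) : Type :=
  RingQuot (fun f g : FreeAlgebra K (Fin n) => IsPI K R (f - g))

end

open scoped TensorProduct SymAlg

section Grassmann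

variable {K V : Type} [Field K] [AddCommGroup V] [Module K V]

theorem commute_of_mem_evenPart {a : ExteriorAlgebra K V} (ha : a ∈ evenPart K V)
    (b : ExteriorAlgebra K V) : Commute a b := by
  have anticomm (u v : V) : ExteriorAlgebra.ι K u * ExteriorAlgebra.ι K v =
      -(ExteriorAlgebra.ι K v * ExteriorAlgebra.ι K u) :=
    eq_neg_of_add_eq_zero_left (ExteriorAlgebra.ι_add_mul_swap u v)
  induction a, ha using CliffordAlgebra.even_induction with
  | algebraMap r => exact Algebra.commutes r b
  | add x y _ _ hx hy => exact hx.add_left hy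
  | ι_mul_ι_mul u v x _ hx =>
    refine Commute.mul_left ?_ hx
    clear hx
    induction b using ExteriorAlgebra.induction with
    | algebraMap r => exact (Algebra.commutes r _).symm
    | ι w =>
      change ExteriorAlgebra.ι K u * ExteriorAlgebra.ι K v * ExteriorAlgebra.ι K w =
        ExteriorAlgebra.ι K w * (ExteriorAlgebra.ι K u * ExteriorAlgebra.ι K v)
      rw [mul_assoc, anticomm v w, mul_neg, ← mul_assoc, anticomm u w, neg_mul, neg_neg, mul_assoc]
    | mul c d hc hd => exact hc.mul_right hd
    | add c d hc hd => exact hc.add_right hd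

theorem br_mem_evenPart (a b : ExteriorAlgebra K V) : br a b ∈ evenPart K V := by
  have split (c : ExteriorAlgebra K V) : ∃ c₀ ∈ evenPart K V, ∃ c₁ ∈ oddPart K V, c₀ + c₁ = c :=
    Submodule.mem_sup.1 <|
      (CliffordAlgebra.evenOdd_isCompl (0 : QuadraticForm K V)).sup_eq_top ▸ Submodule.mem_top
  have odd_mul {c d : ExteriorAlgebra K V} (hc : c ∈ oddPart K V) (hd : d ∈ oddPart K V) :
      c * d ∈ evenPart K V :=
    CliffordAlgebra.evenOdd_mul_le (Q := (0 : QuadraticForm K V)) 1 1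
      (Submodule.mul_mem_mul hc hd)
  obtain ⟨a₀, ha₀, a₁, ha₁, rfl⟩ := split a
  obtain ⟨b₀, hb₀, b₁, hb₁, rfl⟩ := split b
  have key : br (a₀ + a₁) (b₀ + b₁) = a₁ * b₁ - b₁ * a₁ := by
    have h₁ := (commute_of_mem_evenPart ha₀ (b₀ + b₁)).eq
    have h₂ := (commute_of_mem_evenPart hb₀ a₁).eq
    rw [br, add_mul, mul_add (b₀ + b₁), h₁, mul_add a₁, add_mul b₀ b₁ a₁, h₂]
    abel
  rw [key]
  exact Submodule.sub_mem _ (odd_mul ha₁ hb₁) (odd_mul hb₁ ha₁)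

theorem exteriorAlgebra_br_br (a b c : ExteriorAlgebra K V) : br (br a b) c = 0 :=
  sub_eq_zero.2 (commute_of_mem_evenPart (br_mem_evenPart a b) c)

end Grassmann

section CentralCommutators

variable {K A : Type} [Field K] [Ring A] [Algebra K A]

theorem commute_br (h : ∀ a b c : A, br (br a b) c = 0) (a b c : A) : Commute (br a b) c :=
  sub_eq_zero.1 (h a b c)

theorem br_smul_left (r : K) (a b : A) : br (r • a) b = r • br a b := by
  simp only [br, smul_mul_assoc, mul_smul_comm, smul_sub]

theorem br_smul_right (r : K) (a b : A) : br a (r • b) = r • br a b := by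
  simp only [br, smul_mul_assoc, mul_smul_comm, smul_sub]

theorem two_mul_br_mul_br (h : ∀ a b c : A, br (br a b) c = 0) (a b c : A) :
    2 * (br a b * br b c) = 0 := by
  have key : 2 * (br a b * br b c) = br (br a (b * b)) c - br (br a b) c * b -
      b * br (br a b) c + br (br a b) (br b c) := by
    unfold br; noncomm_ring
  simp [key, h]

theorem invOf_two_mul [Invertible (2 : A)] [NeZero (2 : K)] (a : A) :
    ⅟2 * a = (2⁻¹ : K) • a := by
  have h : (2 : A) * ((2⁻¹ : K) • a) = a := by
    rw [mul_smul_comm, two_mul, ← two_smul K a, inv_smul_smul₀ two_ne_zero]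
  rw [← h, invOf_mul_cancel_left, h]

/-- If all commutators are central, the Jordan product is associative. -/
abbrev symAlgCommRing [Invertible (2 : A)] (h : ∀ a b c : A, br (br a b) c = 0) :
    CommRing Aˢʸᵐ where
  __ := (inferInstance : NonAssocRing Aˢʸᵐ)
  mul_comm := SymAlg.mul_comm
  mul_assoc a b c := by
    obtain ⟨a, rfl⟩ := SymAlg.sym_surjective a
    obtain ⟨b, rfl⟩ := SymAlg.sym_surjective b
    obtain ⟨c, rfl⟩ := SymAlg.sym_surjective c
    have comm (x : A) : Commute x (⅟2) := (Commute.ofNat_right x 2).invOf_right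
    have key : (a * b + b * a) * c + c * (a * b + b * a) - (a * (b * c + c * b) +
        (b * c + c * b) * a) = - br (br a c) b := by
      unfold br; noncomm_ring
    rw [h, neg_zero, sub_eq_zero] at key
    simp only [SymAlg.sym_mul_sym]
    rw [← mul_assoc c, ← mul_assoc a, (comm c).eq, (comm a).eq, mul_assoc _ _ c, mul_assoc _ _ a,
      mul_assoc _ c, mul_assoc _ a, ← mul_add, ← mul_add, key]

/-- The symmetrized product of two elements, with the factor `1/2` taken in the base field. -/
theorem sym_mul_sym_eq_smul [Invertible (2 : A)] [NeZero (2 : K)] (a b : A) :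
    SymAlg.sym a * SymAlg.sym b = SymAlg.sym ((2⁻¹ : K) • (a * b + b * a)) := by
  rw [SymAlg.sym_mul_sym, invOf_two_mul (K := K)]

theorem sym_mul_sym_of_commute [Invertible (2 : A)] {a b : A} (hab : Commute a b) :
    SymAlg.sym a * SymAlg.sym b = SymAlg.sym (a * b) := by
  rw [SymAlg.sym_mul_sym, ← hab.eq, ← two_mul, invOf_mul_cancel_left]

/-- The symmetrized algebra of an algebra with central commutators is a commutative algebra. -/
abbrev symAlgAlgebra [Invertible (2 : A)] [NeZero (2 : K)] (h : ∀ a b c : A, br (br a b) c = 0) :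
    letI := symAlgCommRing h
    Algebra K Aˢʸᵐ :=
  letI := symAlgCommRing h
  have smul_mul (r : K) (x y : Aˢʸᵐ) : r • x * y = r • (x * y) := by
    obtain ⟨x, rfl⟩ := SymAlg.sym_surjective x
    obtain ⟨y, rfl⟩ := SymAlg.sym_surjective y
    rw [← SymAlg.sym_smul, sym_mul_sym_eq_smul (K := K), sym_mul_sym_eq_smul (K := K),
      ← SymAlg.sym_smul, smul_mul_assoc, mul_smul_comm, ← smul_add, smul_comm]
  Algebra.ofModule smul_mul fun r x y => by
    rw [SymAlg.mul_comm, smul_mul, SymAlg.mul_comm]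

variable {V : Type} [AddCommGroup V] [Module K V]

/-- The bilinear map `(u, v) ↦ [g u, g v] / 2`, which extends to the even exterior algebra. -/
def commutatorEvenHom [Invertible (2 : A)] [NeZero (2 : K)] (h : ∀ a b c : A, br (br a b) c = 0)
    (g : V →ₗ[K] A) :
    letI := symAlgCommRing h
    letI := symAlgAlgebra (K := K) h
    CliffordAlgebra.EvenHom (0 : QuadraticForm K V) Aˢʸᵐ :=
  letI := symAlgCommRing h
  letI := symAlgAlgebra (K := K) h
  { bilin := LinearMap.mk₂ K (fun u v => SymAlg.sym ((2⁻¹ : K) • br (g u) (g v)))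
      (fun u v w => by
        rw [← SymAlg.sym_add, ← smul_add, map_add]; congr 2; unfold br; noncomm_ring)
      (fun r u v => by
        rw [← SymAlg.sym_smul, smul_comm, map_smul g, br_smul_left])
      (fun u v w => by
        rw [← SymAlg.sym_add, ← smul_add, map_add]; congr 2; unfold br; noncomm_ring)
      (fun r u v => by
        rw [← SymAlg.sym_smul, smul_comm, map_smul g, br_smul_right])
    contract := fun u => by
      simp [br]
    contract_mid := fun u v w => by
      have key : br (g u) (g v) * br (g v) (g w) = 0 := by
        rw [← invOf_mul_cancel_left (2 : A) (br (g u) (g v) * br (g v) (g w)),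
          two_mul_br_mul_br h, mul_zero]
      rw [LinearMap.mk₂_apply, LinearMap.mk₂_apply, sym_mul_sym_of_commute, smul_mul_assoc,
        mul_smul_comm, key]
      · simp
      · exact ((commute_br h _ _ _).smul_left _).smul_right _ }

end CentralCommutators

section EvenExtension

variable {K V B : Type} [Field K] [AddCommGroup V] [Module K V] [CommRing B] [Algebra K B]

/-- The extension by zero on odd elements of the algebra homomorphism from the even exterior
algebra induced by `F`. -/
def evenExtension (F : CliffordAlgebra.EvenHom (0 : QuadraticForm K V) B) :
    ExteriorAlgebra K V →ₗ[K] B :=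
  (CliffordAlgebra.even.lift _ F).toLinearMap ∘ₗ
    (GradedAlgebra.proj (CliffordAlgebra.evenOdd (0 : QuadraticForm K V)) 0).codRestrict
      (Subalgebra.toSubmodule (CliffordAlgebra.even 0)) fun _ => SetLike.coe_mem _

variable (F : CliffordAlgebra.EvenHom (0 : QuadraticForm K V) B)

theorem evenExtension_of_mem {x : ExteriorAlgebra K V} (hx : x ∈ evenPart K V) :
    evenExtension F x = CliffordAlgebra.even.lift _ F ⟨x, hx⟩ :=
  congrArg (CliffordAlgebra.even.lift _ F) <| Subtype.ext <|
    DirectSum.decompose_of_mem_same _ hx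

theorem evenExtension_one : evenExtension F 1 = 1 := by
  rw [evenExtension_of_mem F (SetLike.one_mem_graded _)]
  exact map_one (CliffordAlgebra.even.lift _ F)

theorem evenExtension_ι (v : V) : evenExtension F (ExteriorAlgebra.ι K v) = 0 := by
  refine (congrArg (CliffordAlgebra.even.lift _ F) <| Subtype.ext ?_).trans (map_zero _)
  exact DirectSum.decompose_of_mem_ne _ (CliffordAlgebra.ι_mem_evenOdd_one _ v) one_ne_zero

theorem evenExtension_ι_mul_ι (u v : V) :
    evenExtension F (ExteriorAlgebra.ι K u * ExteriorAlgebra.ι K v) = F.bilin u v := by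
  rw [evenExtension_of_mem F (CliffordAlgebra.ι_mul_ι_mem_evenOdd_zero _ u v)]
  exact CliffordAlgebra.even.lift_ι _ F u v

theorem evenExtension_mul (x : ExteriorAlgebra K V) {y : ExteriorAlgebra K V}
    (hy : y ∈ evenPart K V) :
    evenExtension F (x * y) = evenExtension F x * evenExtension F y := by
  rw [evenExtension_of_mem F hy]
  refine (congrArg (CliffordAlgebra.even.lift _ F) <| Subtype.ext ?_).trans (map_mul _ _ _)
  exact DirectSum.coe_decompose_mul_of_right_mem_zero _ hy

/-- The linear map `p ⊗ ω ↦ p(g) F(ω)`, which vanishes for odd `ω`. -/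
noncomputable def polyEvenExtension (g : ℕ → B) :
    MvPolynomial ℕ K ⊗[K] ExteriorAlgebra K V →ₗ[K] B :=
  LinearMap.mul' K B ∘ₗ TensorProduct.map (MvPolynomial.aeval g).toLinearMap (evenExtension F)

theorem polyEvenExtension_tmul (g : ℕ → B) (p : MvPolynomial ℕ K) (x : ExteriorAlgebra K V) :
    polyEvenExtension F g (p ⊗ₜ x) = MvPolynomial.aeval g p * evenExtension F x :=
  rfl

theorem polyEvenExtension_mul_tmul (g : ℕ → B) (t : MvPolynomial ℕ K ⊗[K] ExteriorAlgebra K V)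
    (p : MvPolynomial ℕ K) {x : ExteriorAlgebra K V} (hx : x ∈ evenPart K V) :
    polyEvenExtension F g (t * p ⊗ₜ x) =
      polyEvenExtension F g t * (MvPolynomial.aeval g p * evenExtension F x) := by
  induction t with
  | zero => simp
  | add t s ht hs => rw [add_mul, map_add, ht, hs, map_add, add_mul]
  | tmul q y =>
    rw [Algebra.TensorProduct.tmul_mul_tmul, polyEvenExtension_tmul, polyEvenExtension_tmul,
      map_mul, evenExtension_mul F y hx, mul_mul_mul_comm]

end EvenExtension

section GenericSubstitution

variable {K : Type} [Field K]

/-- The generic substitution `xᵢ ↦ yᵢ + eᵢ` with commuting indeterminates `yᵢ`. -/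
noncomputable def genericSubst (K : Type) [Field K] :
    FreeAlgebra K ℕ →ₐ[K] MvPolynomial ℕ K ⊗[K] Einf K :=
  FreeAlgebra.lift K fun i =>
    MvPolynomial.X i ⊗ₜ 1 + 1 ⊗ₜ ExteriorAlgebra.ι K (Finsupp.single i 1)

theorem MvPolynomial.tensorProduct_eq_zero_of_eval [Infinite K] {M : Type} [AddCommGroup M]
    [Module K M] {σ : Type} (t : MvPolynomial σ K ⊗[K] M)
    (ht : ∀ c : σ → K, (MvPolynomial.aeval c : MvPolynomial σ K →ₐ[K] K).toLinearMap.rTensor M t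
      = 0) : t = 0 := by
  let b := Module.Free.chooseBasis K M
  let b' := b.baseChange (MvPolynomial σ K)
  have key (c : σ → K) (i) (s : MvPolynomial σ K ⊗[K] M) : MvPolynomial.aeval c (b'.repr s i) =
      b.repr (TensorProduct.lid K M
        ((MvPolynomial.aeval c : MvPolynomial σ K →ₐ[K] K).toLinearMap.rTensor M s)) i := by
    induction s with
    | zero => simp
    | add s s' h h' => simp only [map_add, Finsupp.add_apply, h, h']
    | tmul p m => simp [b', mul_comm]
  refine b'.repr.map_eq_zero_iff.1 (Finsupp.ext fun i => MvPolynomial.funext fun c => ?_)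
  have := key c i t
  rw [ht, map_zero, map_zero] at this
  simpa [MvPolynomial.aeval_eq_eval] using this

theorem genericSubst_eq_zero [CharZero K] {f : FreeAlgebra K ℕ} (hf : IsPI K (Einf K) f) :
    genericSubst K f = 0 := by
  refine MvPolynomial.tensorProduct_eq_zero_of_eval _ fun c => ?_
  have := hf <| (Algebra.TensorProduct.lid K (Einf K)).toAlgHom.comp <|
    (Algebra.TensorProduct.map (MvPolynomial.aeval c) (AlgHom.id K _)).comp (genericSubst K)
  exact (Algebra.TensorProduct.lid K (Einf K)).map_eq_zero_iff.1 this

end GenericSubstitution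

section Retraction

variable {K A : Type} [Field K] [Ring A] [Algebra K A]

theorem polyEvenExtension_genericSubst [Invertible (2 : A)] [NeZero (2 : K)]
    (h : ∀ a b c : A, br (br a b) c = 0) (φ : FreeAlgebra K ℕ →ₐ[K] A) (f : FreeAlgebra K ℕ) :
    letI := symAlgCommRing h
    letI := symAlgAlgebra (K := K) h
    polyEvenExtension (commutatorEvenHom h (Finsupp.linearCombination K fun i =>
      φ (FreeAlgebra.ι K i))) (fun i => SymAlg.sym (φ (FreeAlgebra.ι K i))) (genericSubst K f) =
      SymAlg.sym (φ f) := by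
  let := symAlgCommRing h
  let := symAlgAlgebra (K := K) h
  set F := commutatorEvenHom h (Finsupp.linearCombination K fun i => φ (FreeAlgebra.ι K i)) with hF
  set g : ℕ → Aˢʸᵐ := fun i => SymAlg.sym (φ (FreeAlgebra.ι K i))
  let e (i : ℕ) : Einf K := ExteriorAlgebra.ι K (Finsupp.single i 1)
  have evenExtension_e (i j : ℕ) : evenExtension F (e i * e j) =
      SymAlg.sym ((2⁻¹ : K) • br (φ (FreeAlgebra.ι K i)) (φ (FreeAlgebra.ι K j))) := by
    rw [evenExtension_ι_mul_ι]
    simp [hF, commutatorEvenHom]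
  have one_mem : (1 : Einf K) ∈ evenPart K (ℕ →₀ K) := SetLike.one_mem_graded _
  let S (f : FreeAlgebra K ℕ) : Prop :=
    polyEvenExtension F g (genericSubst K f) = SymAlg.sym (φ f) ∧
    ∀ i, polyEvenExtension F g (genericSubst K f * 1 ⊗ₜ e i) =
      SymAlg.sym ((2⁻¹ : K) • br (φ f) (φ (FreeAlgebra.ι K i)))
  have S_one : S 1 := by
    refine ⟨?_, fun i => ?_⟩
    · rw [map_one, Algebra.TensorProduct.one_def, polyEvenExtension_tmul, evenExtension_one]
      simp
    · rw [map_one, one_mul, polyEvenExtension_tmul, evenExtension_ι]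
      simp [br]
  have S_mul_ι (f : FreeAlgebra K ℕ) (hf : S f) (j : ℕ) : S (f * FreeAlgebra.ι K j) := by
    have subst_ι : genericSubst K (FreeAlgebra.ι K j) = MvPolynomial.X j ⊗ₜ 1 + 1 ⊗ₜ e j :=
      FreeAlgebra.lift_ι_apply _ _
    refine ⟨?_, fun i => ?_⟩
    · rw [map_mul, subst_ι, mul_add, map_add, hf.2, polyEvenExtension_mul_tmul F g _ _ one_mem,
        hf.1, MvPolynomial.aeval_X, evenExtension_one, mul_one, sym_mul_sym_eq_smul (K := K),
        ← SymAlg.sym_add, map_mul, ← smul_add, br, add_add_sub_cancel, ← two_smul K,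
        inv_smul_smul₀ two_ne_zero]
    · have expand : genericSubst K (f * FreeAlgebra.ι K j) * 1 ⊗ₜ e i =
          genericSubst K f * 1 ⊗ₜ e i * MvPolynomial.X j ⊗ₜ 1 +
            genericSubst K f * 1 ⊗ₜ (e j * e i) := by
        rw [map_mul, subst_ι, mul_assoc, mul_assoc, ← mul_add, add_mul]
        simp only [Algebra.TensorProduct.tmul_mul_tmul, one_mul, mul_one]
      have central (a b : A) (c : K) (d : A) : Commute (c • br a b) d :=
        (commute_br h a b d).smul_left c
      rw [expand, map_add, polyEvenExtension_mul_tmul F g _ _ one_mem, hf.2,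
        polyEvenExtension_mul_tmul F g _ _ (CliffordAlgebra.ι_mul_ι_mem_evenOdd_zero _ _ _),
        hf.1, MvPolynomial.aeval_X, evenExtension_one, mul_one, map_one, one_mul, evenExtension_e,
        sym_mul_sym_of_commute (central ..), sym_mul_sym_of_commute (central ..).symm,
        ← SymAlg.sym_add, smul_mul_assoc, mul_smul_comm, ← smul_add, map_mul]
      congr 2
      unfold br
      noncomm_ring
  have S_mul (y : FreeAlgebra K ℕ) : ∀ f, S f → S (f * y) := by
    induction y using FreeAlgebra.induction with
    | grade0 r =>
      intro f hf
      rw [← Algebra.commutes, ← Algebra.smul_def]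
      refine ⟨?_, fun i => ?_⟩
      · rw [map_smul, map_smul, hf.1, map_smul, SymAlg.sym_smul]
      · rw [map_smul, smul_mul_assoc, map_smul, hf.2, map_smul φ, ← SymAlg.sym_smul, smul_comm,
          br_smul_left]
    | grade1 j => exact fun f hf => S_mul_ι f hf j
    | mul y z hy hz => exact fun f hf => mul_assoc f y z ▸ hz _ (hy f hf)
    | add y z hy hz =>
      intro f hf
      have h₁ := hy f hf
      have h₂ := hz f hf
      rw [mul_add]
      refine ⟨?_, fun i => ?_⟩
      · rw [map_add, map_add, h₁.1, h₂.1, map_add, SymAlg.sym_add]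
      · rw [map_add, add_mul, map_add, h₁.2, h₂.2, map_add, ← SymAlg.sym_add, ← smul_add]
        congr 2
        unfold br
        noncomm_ring
  exact one_mul f ▸ (S_mul f 1 S_one).1

/-- An algebra with central commutators satisfies every identity of the Grassmann algebra. -/
theorem eq_zero_of_isPI_einf [CharZero K] (h : ∀ a b c : A, br (br a b) c = 0)
    {f : FreeAlgebra K ℕ} (hf : IsPI K (Einf K) f) (φ : FreeAlgebra K ℕ →ₐ[K] A) : φ f = 0 := by
  let : Invertible (2 : K) := invertibleOfNonzero two_ne_zero
  let : Invertible (2 : A) := (Invertible.map (algebraMap K A) 2).copy 2 (map_ofNat _ 2).symm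
  have key := polyEvenExtension_genericSubst h φ f
  rw [genericSubst_eq_zero hf, map_zero] at key
  exact key.symm

end Retraction

theorem map_br {R S G : Type} [Ring R] [Ring S] [FunLike G R S] [RingHomClass G R S] (φ : G)
    (a b : R) : φ (br a b) = br (φ a) (φ b) := by
  simp only [br, map_sub, map_mul]

/-- The polynomial identities of `R`, as a two-sided ideal. -/
def identityIdeal (K : Type) [Field K] (R : Type) [Ring R] [Algebra K R] :
    TwoSidedIdeal (FreeAlgebra K ℕ) :=
  TwoSidedIdeal.mk' (TId K R) (fun φ => map_zero φ)
    (fun hf hg φ => by rw [map_add, hf φ, hg φ, add_zero])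
    (fun hf φ => by rw [map_neg, hf φ, neg_zero])
    (fun hf φ => by rw [map_mul, hf φ, mul_zero])
    (fun hf φ => by rw [map_mul, hf φ, zero_mul])

theorem mem_identityIdeal {K R : Type} [Field K] [Ring R] [Algebra K R] {f : FreeAlgebra K ℕ} :
    f ∈ identityIdeal K R ↔ f ∈ TId K R :=
  TwoSidedIdeal.mem_mk' ..

theorem br_br_mem_of_isTIdeal {K : Type} [Field K] {I : TwoSidedIdeal (FreeAlgebra K ℕ)}
    (hI : IsTIdeal K I) (hmem : br (br (xv K 1) (xv K 2)) (xv K 3) ∈ I) (a b c : FreeAlgebra K ℕ) :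
    br (br a b) c ∈ I := by
  have := hI (FreeAlgebra.lift K fun i => if i = 1 then a else if i = 2 then b else c) _ hmem
  simpa [map_br, xv] using this

/-- The T-ideal of polynomial identities of the infinite-dimensional
Grassmann algebra `E` is generated as a T-ideal by the triple commutator `[x₁,x₂,x₃]`. -/
theorem tideal_grassmann_eq_gen_triple_commutator (K : Type) [Field K] [CharZero K] :
    TId K (Einf K) = TIdealGen K {br (br (xv K 1) (xv K 2)) (xv K 3)} := by
  refine Set.Subset.antisymm (fun f hf I hI hmem => ?_) fun f hf => ?_
  · have h : ∀ a b c : I.ringCon.Quotient, br (br a b) c = 0 := by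
      intro a b c
      obtain ⟨a, rfl⟩ := I.ringCon.mk'_surjective a
      obtain ⟨b, rfl⟩ := I.ringCon.mk'_surjective b
      obtain ⟨c, rfl⟩ := I.ringCon.mk'_surjective c
      rw [← map_br, ← map_br]
      exact I.ringCon.eq.2 <| I.mem_iff _ |>.1 <|
        br_br_mem_of_isTIdeal hI (Set.singleton_subset_iff.1 hmem) a b c
    exact I.ringCon.eq.1 (eq_zero_of_isPI_einf h hf (RingCon.mkₐ K I.ringCon))
  · refine mem_identityIdeal.1 (hf _ (fun φ g hg => ?_) ?_)
    · exact mem_identityIdeal.2 fun ψ => mem_identityIdeal.1 hg (ψ.comp φ)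
    · refine Set.singleton_subset_iff.2 (mem_identityIdeal.2 fun φ => ?_)
      rw [map_br, map_br, exteriorAlgebra_br_br]
end

section
/- For every integer k ≥ 1, the Grassmann algebras E^{(2k)} and E^{(2k+1)} satisfy exactly the same polynomial identities: T(E^{(2k)}) = T(E^{(2k+1)}). -/
section GrassmannIdentities

open ExteriorAlgebra TensorProduct

/-- The grading automorphism of the exterior algebra, sending each vector `v` to `-v`. -/
def extParity (K V : Type) [Field K] [AddCommGroup V] [Module K V] :
    ExteriorAlgebra K V →ₐ[K] ExteriorAlgebra K V :=
  ExteriorAlgebra.map (-LinearMap.id)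

variable {K V W : Type} [Field K] [AddCommGroup V] [Module K V] [AddCommGroup W] [Module K W]

@[simp]
theorem extParity_ι (v : V) : extParity K V (ι K v) = -ι K v := by
  simp [extParity]

@[simp]
theorem extParity_extParity (z : ExteriorAlgebra K V) :
    extParity K V (extParity K V z) = z := by
  have : (extParity K V).comp (extParity K V) = AlgHom.id K _ := by
    ext v; simp
  exact DFunLike.congr_fun this z

theorem extParity_map (g : V →ₗ[K] W) (z : ExteriorAlgebra K V) :
    extParity K W (ExteriorAlgebra.map g z) = ExteriorAlgebra.map g (extParity K V z) := by
  have : (extParity K W).comp (ExteriorAlgebra.map g)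
      = (ExteriorAlgebra.map g).comp (extParity K V) := by
    ext v; simp
  exact DFunLike.congr_fun this z

theorem ι_mul_eq_extParity_mul_ι (v : V) (z : ExteriorAlgebra K V) :
    ι K v * z = extParity K V z * ι K v := by
  induction z using ExteriorAlgebra.induction with
  | algebraMap r => simp [Algebra.commutes]
  | ι w => simpa using eq_neg_of_add_eq_zero_left (ι_add_mul_swap v w)
  | mul a b ha hb => rw [map_mul, ← mul_assoc, ha, mul_assoc, hb, mul_assoc]
  | add a b ha hb => rw [map_add, mul_add, ha, hb, add_mul]

/-- Even elements of the exterior algebra are central. -/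
theorem mem_center_of_extParity_eq {c : ExteriorAlgebra K V} (hc : extParity K V c = c) :
    c ∈ Subalgebra.center K (ExteriorAlgebra K V) := by
  rw [Subalgebra.mem_center_iff]
  intro z
  induction z using ExteriorAlgebra.induction with
  | algebraMap r => exact Algebra.commutes r c
  | ι w => rw [ι_mul_eq_extParity_mul_ι, hc]
  | mul a b ha hb => rw [mul_assoc, hb, ← mul_assoc, ha, mul_assoc]
  | add a b ha hb => rw [add_mul, ha, hb, mul_add]

/-- Every element is a combination of `1` and the standard basis vectors with even coefficients. -/
theorem exists_even_coeffs {n : ℕ} (z : Efin K n) :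
    ∃ (c : Efin K n) (d : Fin n → Efin K n), extParity K _ c = c ∧
      (∀ j, extParity K _ (d j) = d j) ∧
      z = c + ∑ j, d j * ι K (Pi.single j 1) := by
  induction z using CliffordAlgebra.right_induction with
  | algebraMap r => exact ⟨algebraMap K _ r, 0, by simp, by simp, by simp⟩
  | add x y hx hy =>
    obtain ⟨c, d, hc, hd, rfl⟩ := hx
    obtain ⟨c', d', hc', hd', rfl⟩ := hy
    refine ⟨c + c', d + d', by simp [hc, hc'], by simp [hd, hd'], ?_⟩
    simp only [Pi.add_apply, add_mul, Finset.sum_add_distrib]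
    abel
  | mul_ι m x hx =>
    obtain ⟨c, d, hc, hd, rfl⟩ := hx
    refine ⟨(∑ j, d j * ι K (Pi.single j 1)) * ι K m, fun j => c * algebraMap K _ (m j),
      by simp [hd], by simp [hc], ?_⟩
    have hm : ι K m = ∑ j, algebraMap K (Efin K n) (m j) * ι K (Pi.single j 1) := by
      conv_lhs => rw [← (Pi.basisFun K (Fin n)).sum_repr m]
      rw [map_sum]
      refine Finset.sum_congr rfl fun j _ => ?_
      rw [map_smul, Algebra.smul_def, Pi.basisFun_repr, Pi.basisFun_apply]
    rw [add_mul, add_comm]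
    congr 1
    simp only [mul_assoc, ← Finset.mul_sum]
    rw [← hm]

theorem ι_inr_mul_left_cancel {z : ExteriorAlgebra K V}
    {y : ExteriorAlgebra K V}
    (h : ExteriorAlgebra.map (LinearMap.inl K V K) y
      + ι K (0, 1) * ExteriorAlgebra.map (LinearMap.inl K V K) z = 0) : z = 0 := by
  have key : ∀ x : ExteriorAlgebra K V, CliffordAlgebra.contractLeft (LinearMap.snd K V K)
      (ExteriorAlgebra.map (LinearMap.inl K V K) x : CliffordAlgebra (0 : QuadraticForm K (V × K)))
        = 0 := by
    intro x
    induction x using CliffordAlgebra.left_induction with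
    | algebraMap r =>
      rw [AlgHom.commutes]; exact CliffordAlgebra.contractLeft_algebraMap _ _ _
    | add a b ha hb => rw [map_add, map_add, ha, hb, add_zero]
    | ι_mul a m ha =>
      rw [map_mul]
      erw [ExteriorAlgebra.map_apply_ι]
      rw [CliffordAlgebra.contractLeft_ι_mul, ha]
      simp
  have h2 := congrArg (CliffordAlgebra.contractLeft (Q := (0 : QuadraticForm K (V × K)))
    (LinearMap.snd K V K)) h
  rw [map_add, key, CliffordAlgebra.contractLeft_ι_mul, key] at h2
  simp only [LinearMap.snd_apply, one_smul, mul_zero, sub_zero, zero_add, map_zero] at h2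
  exact map_injective (R := K) (f := LinearMap.inl K V K) ⟨LinearMap.fst K V K, by ext; simp⟩
    (h2.trans (map_zero _).symm)

theorem map_basis_ExteriorAlgebra_of_forall {I : Type} [LinearOrder I] (b : Module.Basis I K V)
    (p : V →ₗ[K] V) (s : Finset I) (h : ∀ i ∈ s, p (b i) = b i) :
    ExteriorAlgebra.map p (b.ExteriorAlgebra s) = b.ExteriorAlgebra s := by
  rw [ExteriorAlgebra.basis_apply, map_apply_ιMulti]
  congr 1
  ext i
  apply h
  simp [Set.powersetCard.ofFinEmbEquiv_symm_apply]

theorem map_basis_ExteriorAlgebra_of_exists {I : Type} [LinearOrder I] (b : Module.Basis I K V)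
    (p : V →ₗ[K] V) (s : Finset I) {i : I} (his : i ∈ s) (h : p (b i) = 0) :
    ExteriorAlgebra.map p (b.ExteriorAlgebra s) = 0 := by
  rw [ExteriorAlgebra.basis_apply, map_apply_ιMulti]
  obtain ⟨j, hj⟩ := (Set.powersetCard.mem_range_ofFinEmbEquiv_symm_iff_mem
    (Set.powersetCard.prodEquiv.symm s).2 i).mpr his
  apply AlternatingMap.map_coord_zero (i := j)
  exact (congrArg (fun x => p (b x)) hj).trans h

theorem extParity_basis_ExteriorAlgebra {I : Type} [LinearOrder I] (b : Module.Basis I K V)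
    (s : Finset I) :
    extParity K V (b.ExteriorAlgebra s) = (-1 : K) ^ s.card • b.ExteriorAlgebra s := by
  rw [ExteriorAlgebra.basis_apply, extParity, map_apply_ιMulti]
  have hneg := (ιMulti K s.card).map_smul_univ (fun _ => (-1 : K))
    (b ∘ Set.powersetCard.ofFinEmbEquiv.symm (Set.powersetCard.prodEquiv.symm s).2)
  rw [Finset.prod_const, Finset.card_univ, Fintype.card_fin] at hneg
  refine Eq.trans ?_ hneg
  congr 1
  ext i
  simp
  rfl

/-- An element of the exterior algebra of `K ^ (n + 1)` that dies in every exterior algebra of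
`K ^ n` is homogeneous of top degree. -/
theorem extParity_eq_of_forall_map_eq_zero {n : ℕ} {z : Efin K (n + 1)}
    (h : ∀ g : (Fin (n + 1) → K) →ₗ[K] (Fin n → K), ExteriorAlgebra.map g z = 0) :
    extParity K _ z = (-1 : K) ^ (n + 1) • z := by
  set B := (Pi.basisFun K (Fin (n + 1))).ExteriorAlgebra with hB
  have hrepr : ∀ s : Finset (Fin (n + 1)), ∀ j ∉ s, B.repr z s = 0 := by
    intro s j hj
    set r : (Fin (n + 1) → K) →ₗ[K] (Fin n → K) := LinearMap.funLeft K K j.succAbove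
    set t : (Fin n → K) →ₗ[K] (Fin (n + 1) → K) :=
      Fintype.linearCombination K (fun i => Pi.single (j.succAbove i) 1)
    have hself : (t ∘ₗ r) (Pi.basisFun K (Fin (n + 1)) j) = 0 := by
      have : r (Pi.basisFun K (Fin (n + 1)) j) = 0 := by
        ext i
        simp [r, LinearMap.funLeft_apply, Fin.succAbove_ne]
      rw [LinearMap.comp_apply, this, map_zero]
    have hne : ∀ i ≠ j, (t ∘ₗ r) (Pi.basisFun K (Fin (n + 1)) i)
        = Pi.basisFun K (Fin (n + 1)) i := by
      intro i hi
      obtain ⟨i, rfl⟩ := Fin.exists_succAbove_eq hi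
      have : r (Pi.basisFun K (Fin (n + 1)) (j.succAbove i)) = Pi.single i 1 := by
        ext l
        simp [r, LinearMap.funLeft_apply, Pi.single_apply]
      rw [LinearMap.comp_apply, this]
      simp [t]
    have hcoord : B.coord s ∘ₗ (ExteriorAlgebra.map (t ∘ₗ r)).toLinearMap = B.coord s := by
      refine B.ext fun u => ?_
      rw [LinearMap.comp_apply, AlgHom.toLinearMap_apply]
      by_cases hu : j ∈ u
      · rw [hB, map_basis_ExteriorAlgebra_of_exists _ _ _ hu hself, ← hB, map_zero]
        have : u ≠ s := by rintro rfl; exact hj hu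
        simp [this]
      · rw [hB, map_basis_ExteriorAlgebra_of_forall]
        intro i hi
        exact hne i (by rintro rfl; exact hu hi)
    have hz : ExteriorAlgebra.map (t ∘ₗ r) z = 0 := by
      rw [← ExteriorAlgebra.map_comp_map, AlgHom.comp_apply, h r, map_zero]
    have := LinearMap.congr_fun hcoord z
    rw [LinearMap.comp_apply, AlgHom.toLinearMap_apply, hz, map_zero] at this
    exact this.symm
  have hz : z = B.repr z Finset.univ • B Finset.univ := by
    conv_lhs => rw [← B.sum_repr z]
    refine Finset.sum_eq_single _ (fun s _ hs => ?_) (by simp)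
    obtain ⟨j, hj⟩ : ∃ j, j ∉ s := by
      by_contra! hc
      exact hs (Finset.eq_univ_iff_forall.mpr hc)
    rw [hrepr s j hj, zero_smul]
  rw [hz, map_smul, hB, extParity_basis_ExteriorAlgebra, smul_comm]
  simp

/-- Specialization of polynomial coefficients at a `K`-point. -/
noncomputable def evalCoeffs (K : Type) [Field K] (σ A : Type) [Ring A] [Algebra K A] (p : σ → K) :
    MvPolynomial σ K ⊗[K] A →ₐ[K] A :=
  Algebra.TensorProduct.lift ((Algebra.ofId K A).comp (MvPolynomial.aeval p)) (AlgHom.id K A)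
    (fun x y => Algebra.commutes (MvPolynomial.aeval p x) y)

theorem evalCoeffs_tmul {σ A : Type} [Ring A] [Algebra K A] (p : σ → K)
    (q : MvPolynomial σ K) (a : A) :
    evalCoeffs K σ A p (q ⊗ₜ a) = MvPolynomial.eval p q • a := by
  rw [Algebra.smul_def]
  rfl

theorem eq_zero_of_forall_evalCoeffs [Infinite K] {σ A : Type} [Ring A] [Algebra K A]
    {z : MvPolynomial σ K ⊗[K] A} (h : ∀ p, evalCoeffs K σ A p z = 0) : z = 0 := by
  set b := Module.Basis.ofVectorSpace K A
  set b' := Algebra.TensorProduct.basis (MvPolynomial σ K) b with hb'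
  have key : ∀ (p : σ → K) (w : MvPolynomial σ K ⊗[K] A) i,
      MvPolynomial.eval p (b'.repr w i) = b.repr (evalCoeffs K σ A p w) i := by
    intro p w i
    induction w with
    | zero => simp
    | tmul q a =>
      rw [evalCoeffs_tmul, hb', Algebra.TensorProduct.basis_repr_tmul]
      simp
    | add x y hx hy => simp only [map_add, Finsupp.add_apply, hx, hy]
  refine b'.repr.injective (Finsupp.ext fun i => MvPolynomial.funext fun p => ?_)
  rw [key, h]
  simp

/-- The element `xᵢ + ∑ⱼ xᵢⱼ eⱼ` of the Grassmann algebra with polynomial coefficients. -/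
noncomputable def genericElement (K : Type) [Field K] (n : ℕ) (i : ℕ) :
    MvPolynomial (ℕ ⊕ ℕ × Fin n) K ⊗[K] Efin K n :=
  MvPolynomial.X (Sum.inl i) ⊗ₜ 1 +
    ∑ j, MvPolynomial.X (Sum.inr (i, j)) ⊗ₜ ι K (Pi.single j 1)

/-- If `f` takes odd values on all substitutions of elements of degree at most one, then so does
its value at the generic elements. -/
theorem map_extParity_genericElement [Infinite K] {n : ℕ} {f : FreeAlgebra K ℕ}
    (hf : ∀ (r : ℕ → K) (v : ℕ → Fin n → K),
      extParity K _ (FreeAlgebra.lift K (fun i => algebraMap K (Efin K n) (r i) + ι K (v i)) f)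
        = -FreeAlgebra.lift K (fun i => algebraMap K (Efin K n) (r i) + ι K (v i)) f) :
    Algebra.TensorProduct.map (AlgHom.id K _) (extParity K (Fin n → K))
        (FreeAlgebra.lift K (genericElement K n) f)
      = -FreeAlgebra.lift K (genericElement K n) f := by
  rw [← sub_eq_zero]
  refine eq_zero_of_forall_evalCoeffs fun p => ?_
  have hpar : (evalCoeffs K _ (Efin K n) p).comp
      (Algebra.TensorProduct.map (AlgHom.id K _) (extParity K (Fin n → K)))
      = (extParity K (Fin n → K)).comp (evalCoeffs K _ (Efin K n) p) := by
    refine Algebra.TensorProduct.ext' fun a b => ?_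
    simp [evalCoeffs_tmul]
  have hgen : (evalCoeffs K _ (Efin K n) p).comp (FreeAlgebra.lift K (genericElement K n))
      = FreeAlgebra.lift K (fun i => algebraMap K (Efin K n) (p (Sum.inl i)) +
          ι K (fun j => p (Sum.inr (i, j)))) := by
    ext i
    have : (fun j => p (Sum.inr (i, j))) = ∑ j, p (Sum.inr (i, j)) • Pi.single j (1 : K) := by
      ext l
      simp [Finset.sum_apply, Pi.single_apply]
    simp [genericElement, evalCoeffs_tmul, Algebra.algebraMap_eq_smul_one, this, -smul_eq_mul]
  have hev := DFunLike.congr_fun hgen f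
  rw [AlgHom.comp_apply] at hev
  rw [map_sub, map_neg, ← AlgHom.comp_apply, hpar, AlgHom.comp_apply, hev, hf, sub_self]

theorem eq_zero_of_extParity_eq_neg [CharZero K] {n : ℕ} {f : FreeAlgebra K ℕ}
    (hf : ∀ (r : ℕ → K) (v : ℕ → Fin n → K),
      extParity K _ (FreeAlgebra.lift K (fun i => algebraMap K (Efin K n) (r i) + ι K (v i)) f)
        = -FreeAlgebra.lift K (fun i => algebraMap K (Efin K n) (r i) + ι K (v i)) f)
    (φ : FreeAlgebra K ℕ →ₐ[K] Efin K n) : φ f = 0 := by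
  choose c d hc hd hφ using fun i => exists_even_coeffs (φ (FreeAlgebra.ι K i))
  set inc := ExteriorAlgebra.map (LinearMap.inl K (Fin n → K) K) with hinc
  set par := extParity K ((Fin n → K) × K) with hpar
  set θ := ι K ((0, 1) : (Fin n → K) × K) with hθ
  set e : Fin n → ExteriorAlgebra K ((Fin n → K) × K) := fun j => inc (ι K (Pi.single j 1)) with he
  have hpe : ∀ j, par (e j) = - e j := fun j => by simp [hpar, he, hinc]
  have hpθ : par θ = -θ := by simp [hpar, hθ]
  have hθθ : θ * θ = 0 := ι_sq_zero _
  set b : ℕ → ExteriorAlgebra K ((Fin n → K) × K) := fun i => ∑ j, inc (d i j) * e j with hb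
  have hpd : ∀ i j, par (inc (d i j)) = inc (d i j) := fun i j => by
    rw [hpar, hinc, extParity_map, hd]
  have hpc : ∀ i, par (inc (c i)) = inc (c i) := fun i => by
    rw [hpar, hinc, extParity_map, hc]
  have hpb : ∀ i, par (b i) = - b i := fun i => by simp [hb, hpd, hpe]
  have hφ' : ∀ i, inc (φ (FreeAlgebra.ι K i)) = inc (c i) + b i := fun i => by
    simp [hφ, hb, he]
  -- the coefficients of the conjugated substitution
  have hceven : ∀ i, par (inc (c i) + θ * b i) = inc (c i) + θ * b i := fun i => by
    rw [map_add, map_mul, hpc, hpθ, hpb, neg_mul_neg]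
  let q : ℕ ⊕ ℕ × Fin n → Subalgebra.center K (ExteriorAlgebra K ((Fin n → K) × K)) :=
    Sum.elim (fun i => ⟨inc (c i) + θ * b i, mem_center_of_extParity_eq (hceven i)⟩)
      (fun ij => ⟨inc (d ij.1 ij.2), mem_center_of_extParity_eq (hpd ij.1 ij.2)⟩)
  let h : MvPolynomial (ℕ ⊕ ℕ × Fin n) K ⊗[K] Efin K n →ₐ[K]
      ExteriorAlgebra K ((Fin n → K) × K) :=
    Algebra.TensorProduct.lift ((Subalgebra.center K _).val.comp (MvPolynomial.aeval q)) inc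
      (fun x y => ((Subalgebra.mem_center_iff.mp (MvPolynomial.aeval q x).2) (inc y)).symm)
  have hX : ∀ s, h (MvPolynomial.X s ⊗ₜ 1) = q s := fun s =>
    (Algebra.TensorProduct.lift_tmul _ _ _ _ _).trans (by rw [map_one, mul_one]; simp)
  have hX' : ∀ s, h (Algebra.TensorProduct.map (AlgHom.id K _) (extParity K (Fin n → K))
      (MvPolynomial.X s ⊗ₜ 1)) = q s := fun s => by
    rw [Algebra.TensorProduct.map_tmul, map_one]
    exact hX s
  have hq : ∀ s, par (q s) = q s := fun s =>
    match s with
    | .inl i => hceven i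
    | .inr ij => hpd ij.1 ij.2
  have hh : par.comp h = h.comp (Algebra.TensorProduct.map (AlgHom.id K _)
      (extParity K (Fin n → K))) := by
    apply Algebra.TensorProduct.ext
    · ext s
      change par (h (MvPolynomial.X s ⊗ₜ 1)) = h (Algebra.TensorProduct.map (AlgHom.id K _)
        (extParity K (Fin n → K)) (MvPolynomial.X s ⊗ₜ 1))
      rw [hX', hX]
      exact hq s
    · ext v
      simp [h, hpar, hinc]
  have hgen : ∀ i, h (genericElement K n i) = inc (c i) + θ * b i + b i := fun i => by
    simp [genericElement, h, q, hb, he]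
  set w := h (FreeAlgebra.lift K (genericElement K n) f) with hw
  set z := inc (φ f) with hz
  have hpw : par w = -w := by
    rw [hw, ← AlgHom.comp_apply, hh, AlgHom.comp_apply, map_extParity_genericElement hf, map_neg]
  have hconj : ∀ g, h (FreeAlgebra.lift K (genericElement K n) g) * (2 + θ)
      = (2 + θ) * inc (φ g) := by
    intro g
    induction g using FreeAlgebra.induction with
    | grade0 r => simp only [AlgHom.commutes, Algebra.commutes]
    | grade1 i =>
      have hbθ : b i * θ = - (θ * b i) := by
        rw [hθ, ι_mul_eq_extParity_mul_ι, ← hpar, hpb, neg_mul, neg_neg]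
      have hcθ : inc (c i) * θ = θ * inc (c i) := by
        rw [hθ, ι_mul_eq_extParity_mul_ι, ← hpar, hpc]
      have hθbθ : θ * b i * θ = 0 := by
        rw [mul_assoc, hbθ, mul_neg, ← mul_assoc, hθθ, zero_mul, neg_zero]
      rw [FreeAlgebra.lift_ι_apply, hgen, hφ', mul_add, add_mul _ _ θ, add_mul _ _ θ, hθbθ, hbθ,
        hcθ]
      simp only [mul_two, add_mul, mul_add, two_mul]
      abel
    | mul x y hx hy =>
      rw [map_mul, map_mul, map_mul, map_mul, mul_assoc, hy, ← mul_assoc, hx, mul_assoc]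
    | add x y hx hy => rw [map_add, map_add, map_add, map_add, add_mul _ _ (2 + θ), hx, hy, ← mul_add]
  have h1 : w * (2 + θ) = (2 + θ) * z := hconj f
  have h2 : w * (2 - θ) = -((2 - θ) * par z) := by
    have := congrArg par h1
    rw [map_mul, map_mul, hpw, map_add, hpθ, map_ofNat, ← sub_eq_add_neg] at this
    rw [← this, neg_mul, neg_neg]
  have hzθ : par z * θ = θ * z := (ι_mul_eq_extParity_mul_ι _ z).symm
  have hzθ' : z * θ = θ * par z := by
    rw [hθ, ι_mul_eq_extParity_mul_ι, ← hpar, hpar, extParity_extParity]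
  have h3 : (4 : K) • (z + par z + θ * (z - par z)) = 0 := by
    rw [ofNat_smul_eq_nsmul K 4]
    linear_combination (norm := noncomm_ring) h2 * (2 + θ) - h1 * (2 - θ)
      + 2 * hzθ' - 2 * hzθ + θ * hzθ' + θ * hzθ + hθθ * (z + par z)
  have h4 := (smul_eq_zero.mp h3).resolve_left (by norm_num)
  have hpz : par z = inc (extParity K _ (φ f)) := extParity_map _ _
  rw [hpz, hz, ← map_add, ← map_sub] at h4
  have h5 := ι_inr_mul_left_cancel h4
  rw [h5, map_zero, mul_zero, add_zero, ← sub_eq_zero.mp h5, ← two_smul K, map_smul] at h4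
  have h6 := (smul_eq_zero.mp h4).resolve_left two_ne_zero
  exact map_injective (R := K) (f := LinearMap.inl K (Fin n → K) K)
    ⟨LinearMap.fst K _ K, by ext; simp⟩ (h6.trans (map_zero _).symm)

end GrassmannIdentities

/-- For `k ≥ 1`, the Grassmann algebras `E⁽²ᵏ⁾` and `E⁽²ᵏ⁺¹⁾` satisfy
exactly the same polynomial identities. -/
theorem tideal_grassmann_even_eq_odd (K : Type) [Field K] [CharZero K] (k : ℕ) (hk : 1 ≤ k) :
    TId K (Efin K (2 * k)) = TId K (Efin K (2 * k + 1)) := by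
  ext f
  refine ⟨fun hf => ?_, fun hf φ => ?_⟩
  · have hf' : ∀ φ : FreeAlgebra K ℕ →ₐ[K] Efin K (2 * k), φ f = 0 := hf
    refine eq_zero_of_extParity_eq_neg fun r v => ?_
    set ψ := FreeAlgebra.lift K (fun i =>
      algebraMap K (Efin K (2 * k + 1)) (r i) + ExteriorAlgebra.ι K (v i))
    have hψ : ∀ g : (Fin (2 * k + 1) → K) →ₗ[K] (Fin (2 * k) → K),
        ExteriorAlgebra.map g (ψ f) = 0 := fun g => hf' ((ExteriorAlgebra.map g).comp ψ)
    rw [extParity_eq_of_forall_map_eq_zero hψ, Odd.neg_one_pow ⟨k, rfl⟩, neg_one_smul]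
  · have hf' : ∀ φ : FreeAlgebra K ℕ →ₐ[K] Efin K (2 * k + 1), φ f = 0 := hf
    have hs : LinearMap.funLeft K K Fin.castSucc ∘ₗ
        Fintype.linearCombination K (fun i : Fin (2 * k) =>
          (Pi.single i.castSucc 1 : Fin (2 * k + 1) → K)) = LinearMap.id := by
      ext i j
      simp [Pi.single_apply]
    exact ExteriorAlgebra.map_injective (R := K) ⟨_, hs⟩
      ((hf' ((ExteriorAlgebra.map _).comp φ)).trans (map_zero _).symm)
end
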